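/- If G is a finite simple graph with at least two vertices and with no induced path P4 on four vertices, then G is disconnected or the complement of G is disconnected. -/

import Mathlib

/-- A simple graph is `P4`-free if no four (distinct) vertices induce a subgraph
isomorphic to the path on four vertices with three edges. -/
def IsP4Free {V : Type*} (G : SimpleGraph V) : Prop :=
  ¬ ∃ a b c d : V, a ≠ b ∧ a ≠ c ∧ a ≠ d ∧ b ≠ c ∧ b ≠ d ∧ c ≠ d ∧
      G.Adj a b ∧ G.Adj b c ∧ G.Adj c d ∧ ¬ G.Adj a c ∧ ¬ G.Adj a d ∧ ¬ G.Adj b d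

/-- The set `S` splits into two nonempty parts with no edge of `G` between them. -/
def SimpleGraph.IsSeparated {V : Type*} (G : SimpleGraph V) (S : Set V) : Prop :=
  ∃ A ⊆ S, A.Nonempty ∧ (S \ A).Nonempty ∧ ∀ a ∈ A, ∀ b ∈ S \ A, ¬ G.Adj a b

theorem IsP4Free.compl {V : Type*} {G : SimpleGraph V} (h : IsP4Free G) : IsP4Free Gᶜ := by
  rintro ⟨a, b, c, d, hab, hac, had, hbc, hbd, hcd, h₁, h₂, h₃, h₄, h₅, h₆⟩
  simp only [SimpleGraph.compl_adj] at h₁ h₂ h₃ h₄ h₅ h₆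
  refine h ⟨c, a, d, b, ?_⟩
  grind [G.adj_comm]

theorem SimpleGraph.isSeparated_compl_insert {V : Type*} {G : SimpleGraph V} {S : Set V} {v : V}
    (hS : S.Nonempty) (hv : v ∉ S) (h : ∀ x ∈ S, G.Adj v x) : Gᶜ.IsSeparated (insert v S) := by
  obtain ⟨x, hx⟩ := hS
  refine ⟨{v}, by simp, by simp, ⟨x, by grind⟩, ?_⟩
  rintro a rfl b ⟨hb, hba⟩ hadj
  exact (G.compl_adj a b).1 hadj |>.2 (h b (hb.resolve_left hba))

theorem SimpleGraph.IsSeparated.of_not_adj {V : Type*} {G : SimpleGraph V} {S A : Set V} {v u : V}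
    (hp4 : IsP4Free G) (hv : v ∉ S) (hA : A ⊆ S) (hB : (S \ A).Nonempty)
    (hAB : ∀ a ∈ A, ∀ b ∈ S \ A, ¬ G.Adj a b) (hu : u ∈ A) (hvu : ¬ G.Adj v u) :
    G.IsSeparated (insert v S) := by
  by_cases hy : ∃ y ∈ S \ A, G.Adj v y
  · obtain ⟨y, hy, hvy⟩ := hy
    -- The non-neighbours of `v` in `A` form a separated part, else there is an induced path.
    refine ⟨{x ∈ A | ¬ G.Adj v x}, fun x hx => Or.inr (hA hx.1), ⟨u, hu, hvu⟩,
      ⟨v, by simp, fun h => hv (hA h.1)⟩, ?_⟩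
    rintro a ⟨ha, hva⟩ b ⟨hb, hbN⟩ hab
    rcases hb with rfl | hb
    · exact hva hab.symm
    by_cases hbA : b ∈ A
    · have hvb : G.Adj v b := by_contra fun h => hbN ⟨hbA, h⟩
      have hby := hAB b hbA y hy
      have hay := hAB a ha y hy
      refine hp4 ⟨y, v, b, a, ?_⟩
      have := hA ha
      grind [G.adj_comm]
    · exact hAB a ha b ⟨hb, hbA⟩ hab
  · push Not at hy
    refine ⟨S \ A, fun x hx => Or.inr hx.1, hB, ⟨u, Or.inr (hA hu), fun h => h.2 hu⟩, ?_⟩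
    rintro a ha b ⟨hb, hbB⟩ hab
    rcases hb with rfl | hb
    · exact hy a ha hab.symm
    · exact hAB b (by_contra fun h => hbB ⟨hb, h⟩) a ha hab.symm

theorem SimpleGraph.IsSeparated.insert_or_compl {V : Type*} {G : SimpleGraph V} {S : Set V} {v : V}
    (hp4 : IsP4Free G) (hv : v ∉ S) (hS : G.IsSeparated S) :
    G.IsSeparated (insert v S) ∨ Gᶜ.IsSeparated (insert v S) := by
  obtain ⟨A, hA, hne, hB, hAB⟩ := hS
  by_cases h : ∀ x ∈ S, G.Adj v x
  · exact Or.inr (isSeparated_compl_insert (hne.mono hA) hv h)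
  push Not at h
  obtain ⟨u, hu, hvu⟩ := h
  left
  by_cases huA : u ∈ A
  · exact .of_not_adj hp4 hv hA hB hAB huA hvu
  · have hAA : S \ (S \ A) = A := Set.sdiff_sdiff_cancel_left hA
    refine .of_not_adj hp4 hv (A := S \ A) Set.sdiff_subset (by rwa [hAA]) ?_ ⟨hu, huA⟩ hvu
    rw [hAA]
    exact fun b hb a ha hab => hAB a ha b hb hab.symm

theorem IsP4Free.isSeparated_or_compl {V : Type*} {G : SimpleGraph V} (hp4 : IsP4Free G)
    {S : Set V} (hfin : S.Finite) (hS : S.Nontrivial) : G.IsSeparated S ∨ Gᶜ.IsSeparated S := by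
  induction S, hfin using Set.Finite.induction_on with
  | empty => simp at hS
  | @insert v S hv _ ih =>
    rcases S.subsingleton_or_nontrivial with hsub | hnt
    · rcases hsub.eq_empty_or_singleton with rfl | ⟨x, rfl⟩
      · simp at hS
      · by_cases hvx : G.Adj v x
        · exact Or.inr (SimpleGraph.isSeparated_compl_insert (by simp) hv (by simpa))
        · have hne : v ≠ x := hv
          have := SimpleGraph.isSeparated_compl_insert (G := Gᶜ) (S := {x}) (by simp) hv
            (by simpa using ⟨hne, hvx⟩)
          exact Or.inl (by simpa using this)
    · rcases ih hnt with h | h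
      · exact h.insert_or_compl hp4 hv
      · simpa [or_comm] using h.insert_or_compl hp4.compl hv

theorem SimpleGraph.IsSeparated.not_connected {V : Type*} {G : SimpleGraph V}
    (h : G.IsSeparated Set.univ) : ¬ G.Connected := by
  obtain ⟨A, -, ⟨a, ha⟩, ⟨b, -, hb⟩, hAB⟩ := h
  intro hc
  obtain ⟨p⟩ := hc.preconnected a b
  obtain ⟨d, -, h₁, h₂⟩ := p.exists_boundary_dart A ha hb
  exact hAB _ h₁ _ ⟨trivial, h₂⟩ d.adj

/-- A finite `P4`-free simple graph with at least two vertices is disconnected, or its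
complement is disconnected. -/
theorem p4Free_disconnected_or_compl_disconnected {V : Type*} [Fintype V]
    (G : SimpleGraph V) (htwo : ∃ v w : V, v ≠ w) (hp4 : IsP4Free G) :
    ¬ G.Connected ∨ ¬ Gᶜ.Connected := by
  obtain ⟨v, w, hvw⟩ := htwo
  exact (hp4.isSeparated_or_compl Set.finite_univ ⟨v, trivial, w, trivial, hvw⟩).imp
    SimpleGraph.IsSeparated.not_connected SimpleGraph.IsSeparated.not_connected
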